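/- For every integer g ≥ 1, 1 + CF(l) = 2g/(6g−1) in ℚ, where l is the list [−2, 3] followed by the pair (−2, 2) repeated g−1 times; that is, the signed continued-fraction expansion with integer part r = 1 and partial quotients [−2, 3, (−2,2)^{g−1}] (all of absolute value at least 2) represents 2g/(6g−1). -/

import Mathlib

/-- Continued-fraction value of a list: `CF [n₁, …, n_t] = 1/(n₁ + 1/(n₂ + ⋯ + 1/n_t))`. -/
def CF (l : List ℚ) : ℚ := l.foldr (fun n x => (n + x)⁻¹) 0

theorem CF_cons (a : ℚ) (l : List ℚ) : CF (a :: l) = (a + CF l)⁻¹ := rfl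

theorem CF_flatten_replicate_neg_two_two (m : ℕ) :
    CF (List.flatten (List.replicate m [(-2 : ℚ), 2])) = -(2 * m) / (2 * m + 1) := by
  induction m with
  | zero => simp [CF]
  | succ m ih =>
    rw [List.replicate_succ, List.flatten_cons, List.cons_append, List.cons_append,
      List.nil_append, CF_cons, CF_cons, ih]
    have h₁ : (2 * m + 1 : ℚ) ≠ 0 := by positivity
    have h₂ : (2 * m + 2 : ℚ) ≠ 0 := by positivity
    have inner : (2 + -(2 * m) / (2 * m + 1) : ℚ) = (2 * m + 2) / (2 * m + 1) := by
      field_simp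
      ring
    have outer : (-2 + (2 * m + 1) / (2 * m + 2) : ℚ) = -(2 * m + 3) / (2 * m + 2) := by
      field_simp
      ring
    rw [inner, inv_div, outer, inv_div]
    push_cast
    rw [show (2 * (m + 1) + 1 : ℚ) = 2 * m + 3 by ring, div_neg, neg_div]
    ring

/-- For every integer `g ≥ 1`, `1 + CF ([−2, 3] ++ (−2, 2)^{g−1}) = 2g/(6g−1)` in `ℚ`. -/
theorem cf_signed_expansion_one_three (g : ℕ) (hg : 1 ≤ g) :
    1 + CF ([(-2 : ℚ), 3] ++ List.flatten (List.replicate (g - 1) [(-2 : ℚ), 2])) =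
      (2 * g) / (6 * g - 1) := by
  obtain ⟨m, rfl⟩ := Nat.exists_eq_add_of_le' hg
  rw [Nat.add_sub_cancel, List.cons_append, List.cons_append, List.nil_append, CF_cons, CF_cons,
    CF_flatten_replicate_neg_two_two]
  have h₁ : (2 * m + 1 : ℚ) ≠ 0 := by positivity
  have h₂ : (4 * m + 3 : ℚ) ≠ 0 := by positivity
  have h₃ : (6 * m + 5 : ℚ) ≠ 0 := by positivity
  have inner : (3 + -(2 * m) / (2 * m + 1) : ℚ) = (4 * m + 3) / (2 * m + 1) := by
    field_simp
    ring
  have outer : (-2 + (2 * m + 1) / (4 * m + 3) : ℚ) = -(6 * m + 5) / (4 * m + 3) := by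
    field_simp
    ring
  rw [inner, inv_div, outer, inv_div]
  push_cast
  rw [show (6 * (m + 1) - 1 : ℚ) = 6 * m + 5 by ring, div_neg]
  field_simp
  ring
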